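/- Let N ≥ 1 be an integer, 0 ≤ j ≤ N−1, and let S ⊆ {1,…,N} satisfy 1 ∈ S and |S| = N−j. Let Ψ ∈ L²(ℝ^{3N}; H) be antisymmetric in the variables with indices in S. Let (χ'_i)_{i∈ℕ} and (χ_i)_{i∈ℕ} be orthonormal families in L²(ℝ³) and μ_i ≥ 0 with Σ_i μ_i² < ∞, and set A_1 := Σ_i μ_i (|χ'_i⟩⟨χ_i|)_1, the series converging in operator norm on L²(ℝ^{3N}; H). Then ‖A_1 Ψ‖² ≤ (N−j)^{−1} (Σ_i μ_i²) ‖Ψ‖². -/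

import Mathlib

open MeasureTheory

noncomputable section

abbrev E3 : Type := EuclideanSpace ℝ (Fin 3)

abbrev OneL2 : Type := Lp ℂ 2 (volume : Measure E3)

abbrev NL2 (H : Type) [NormedAddCommGroup H] [InnerProductSpace ℂ H] (N : ℕ) : Type :=
  Lp H 2 (volume : Measure (Fin N → E3))

variable {H : Type} [NormedAddCommGroup H] [InnerProductSpace ℂ H] [CompleteSpace H]

/-- `T` acts as the rank-one operator `(|χ'⟩⟨χ|)` in the `m`-th variable. -/
def IsRankOneAt {N : ℕ} (χ' χ : OneL2) (m : Fin N)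
    (T : NL2 H N →L[ℂ] NL2 H N) : Prop :=
  ∀ Ψ : NL2 H N, (T Ψ : (Fin N → E3) → H) =ᵐ[volume]
    fun x => (χ' : E3 → ℂ) (x m) •
      ∫ y : E3, (starRingEnd ℂ) ((χ : E3 → ℂ) y) • (Ψ : (Fin N → E3) → H) (Function.update x m y)

/-- `Ψ` is antisymmetric in the variables with indices in `S`. -/
def AntisymmetricOn {N : ℕ} (S : Finset (Fin N)) (Ψ : NL2 H N) : Prop :=
  ∀ σ : Equiv.Perm (Fin N), (∀ i ∉ S, σ i = i) →
    (fun x : Fin N → E3 => (Ψ : (Fin N → E3) → H) (x ∘ σ)) =ᵐ[volume]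
      fun x => (((Equiv.Perm.sign σ : ℤ) : ℂ)) • (Ψ : (Fin N → E3) → H) x

section RankOne

variable {F : Type*} [NormedAddCommGroup F] [InnerProductSpace ℂ F]

variable {E : Type*} [MeasureSpace E] {N : ℕ}

/-- The action of `|a⟩⟨b|` in the `m`-th variable on a function `f`. -/
def rankOneFun (a b : E → ℂ) (m : Fin N) (f : (Fin N → E) → F) (x : Fin N → E) : F :=
  a (x m) • ∫ y, (starRingEnd ℂ) (b y) • f (Function.update x m y)

variable {a b c d : E → ℂ} {m l : Fin N} {f g : (Fin N → E) → F}

theorem rankOneFun_comp_self [CompleteSpace F] (x : Fin N → E) :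
    rankOneFun a b m (rankOneFun c d m f) x =
      (∫ y, (starRingEnd ℂ) (b y) * c y) • rankOneFun a d m f x := by
  simp only [rankOneFun, Function.update_self, Function.update_idem, smul_smul]
  rw [integral_smul_const, smul_smul, mul_comm]

theorem rankOneFun_comp_swap (hlm : l ≠ m) (x : Fin N → E) :
    rankOneFun a b l (rankOneFun a b m f) (x ∘ Equiv.swap l m) =
      rankOneFun a b l (rankOneFun a b m f) x := by
  have hu (y z : E) : Function.update (Function.update (x ∘ Equiv.swap l m) l y) m z =
      Function.update (Function.update x l y) m z := by
    funext i
    by_cases him : i = m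
    · simp [him]
    by_cases hil : i = l
    · simp [hil, hlm]
    simp [him, hil, Equiv.swap_apply_of_ne_of_ne hil him]
  have h (x : Fin N → E) : rankOneFun a b l (rankOneFun a b m f) x = (a (x l) * a (x m)) •
      ∫ y, (starRingEnd ℂ) (b y) • ∫ z, (starRingEnd ℂ) (b z) •
        f (Function.update (Function.update x l y) m z) := by
    rw [mul_smul, ← integral_smul (a (x m))]
    simp only [rankOneFun, Function.update_of_ne hlm.symm, smul_comm (a (x m))]
  rw [h, h]
  simp only [hu, Function.comp_apply, Equiv.swap_apply_left, Equiv.swap_apply_right]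
  rw [mul_comm]

variable [SigmaFinite (volume : Measure E)]

theorem measurePreserving_comp_perm (σ : Equiv.Perm (Fin N)) :
    MeasurePreserving (fun x : Fin N → E => x ∘ σ) := by
  have h := volume_measurePreserving_piCongrLeft (fun _ : Fin N => E) σ.symm
  have hσ : ⇑(MeasurableEquiv.piCongrLeft (fun _ : Fin N => E) σ.symm) = fun x => x ∘ σ := by
    funext x i
    have := MeasurableEquiv.piCongrLeft_apply_apply (β := fun _ : Fin N => E) σ.symm x (σ i)
    rwa [σ.symm_apply_apply] at this
  rwa [hσ] at h

/-- Exchanging the `m`-th variable with an extra variable preserves volume. -/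
theorem measurePreserving_exchange (m : Fin N) :
    MeasurePreserving (fun p : (Fin N → E) × E => (Function.update p.1 m p.2, p.1 m)) := by
  have e := volume_preserving_piFinSuccAbove (fun _ : Fin (N + 1) => E) 0
  have h := Measure.measurePreserving_swap.comp ((e.comp ((measurePreserving_comp_perm
    (Equiv.swap 0 m.succ)).comp (e.symm _))).comp
      (Measure.measurePreserving_swap (μ := (volume : Measure (Fin N → E)))
        (ν := (volume : Measure E))))
  refine (congrArg (MeasurePreserving · volume volume) (funext fun p => ?_)).mp h
  ext1
  · funext i
    by_cases hi : i = m
    · subst hi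
      simp [MeasurableEquiv.piFinSuccAbove, Fin.insertNthEquiv, Fin.tail]
    · have : Equiv.swap 0 m.succ i.succ = i.succ :=
        Equiv.swap_apply_of_ne_of_ne (Fin.succ_ne_zero i) (by simpa using hi)
      simp [MeasurableEquiv.piFinSuccAbove, Fin.insertNthEquiv, Fin.tail, this, hi]
  · simp [MeasurableEquiv.piFinSuccAbove, Fin.insertNthEquiv]

theorem MeasureTheory.MemLp.smul_prod_two {α β : Type*} [MeasurableSpace α] [MeasurableSpace β]
    {μ : Measure α} {ν : Measure β} [SFinite μ] [SFinite ν] {f : α → F} {a : β → ℂ}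
    (hf : MemLp f 2 μ) (ha : MemLp a 2 ν) :
    MemLp (fun p : α × β => a p.2 • f p.1) 2 (μ.prod ν) := by
  refine (memLp_two_iff_integrable_sq_norm (ha.1.comp_snd.smul hf.1.comp_fst)).2 ?_
  have := ((memLp_two_iff_integrable_sq_norm hf.1).1 hf).mul_prod
    ((memLp_two_iff_integrable_sq_norm ha.1).1 ha)
  refine this.congr (.of_forall fun p => ?_)
  simp [norm_smul, mul_pow, mul_comm (‖f p.1‖ ^ 2)]

theorem memLp_two_slice {α β V : Type*} [MeasurableSpace α] [MeasurableSpace β]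
    [NormedAddCommGroup V] {μ : Measure α} {ν : Measure β} [SFinite μ] [SFinite ν] {f : α × β → V}
    (hf : MemLp f 2 (μ.prod ν)) : ∀ᵐ x ∂μ, MemLp (fun y => f (x, y)) 2 ν := by
  filter_upwards [((memLp_two_iff_integrable_sq_norm hf.1).1 hf).prod_right_ae,
    hf.1.prodMk_left] with x hx h'x
  exact (memLp_two_iff_integrable_sq_norm h'x).2 hx

theorem sq_norm_integral_smul_le {β : Type*} [MeasurableSpace β] {ν : Measure β}
    {b : β → ℂ} {f : β → F} (hb : MemLp b 2 ν) (hf : MemLp f 2 ν) :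
    ‖∫ y, b y • f y ∂ν‖ ^ 2 ≤ (∫ y, ‖b y‖ ^ 2 ∂ν) * ∫ y, ‖f y‖ ^ 2 ∂ν := by
  have h1 : ‖∫ y, b y • f y ∂ν‖ ≤ ∫ y, ‖b y‖ * ‖f y‖ ∂ν := by
    refine (norm_integral_le_integral_norm _).trans_eq ?_
    simp [norm_smul]
  have h2 := integral_mul_le_Lp_mul_Lq_of_nonneg (μ := ν) (f := fun y => ‖b y‖)
    (g := fun y => ‖f y‖) Real.HolderConjugate.two_two
    (.of_forall fun _ => norm_nonneg _) (.of_forall fun _ => norm_nonneg _)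
    (by simpa using hb.norm) (by simpa using hf.norm)
  simp only [Real.rpow_two, ← Real.sqrt_eq_rpow] at h2
  have h3 := pow_le_pow_left₀ (norm_nonneg _) (h1.trans h2) 2
  rwa [mul_pow, Real.sq_sqrt (by positivity), Real.sq_sqrt (by positivity)] at h3

theorem memLp_two_integral_smul {α β : Type*} [MeasurableSpace α] [MeasurableSpace β]
    {μ : Measure α} {ν : Measure β} [SFinite μ] [SFinite ν] {f : α × β → F} {b : β → ℂ}
    (hf : MemLp f 2 (μ.prod ν)) (hb : MemLp b 2 ν) :
    MemLp (fun x => ∫ y, b y • f (x, y) ∂ν) 2 μ := by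
  have hm : AEStronglyMeasurable (fun x => ∫ y, b y • f (x, y) ∂ν) μ :=
    (hb.1.comp_snd.smul hf.1).integral_prod_right'
  rw [memLp_two_iff_integrable_sq_norm hm]
  refine Integrable.mono'
    ((((memLp_two_iff_integrable_sq_norm hf.1).1 hf).integral_prod_left).const_mul
      (∫ y, ‖b y‖ ^ 2 ∂ν)) (hm.norm.pow 2) ?_
  filter_upwards [memLp_two_slice hf] with x hx
  simpa using sq_norm_integral_smul_le hb hx

theorem memLp_smul_update (ha : MemLp a 2) (hf : MemLp f 2) (m : Fin N) :
    MemLp (fun p : (Fin N → E) × E => a (p.1 m) • f (Function.update p.1 m p.2)) 2 :=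
  (hf.smul_prod_two ha).comp_measurePreserving (measurePreserving_exchange m)

theorem memLp_rankOneFun (ha : MemLp a 2) (hb : MemLp b 2) (hf : MemLp f 2) :
    MemLp (rankOneFun a b m f) 2 := by
  convert memLp_two_integral_smul (memLp_smul_update ha hf m) hb.star using 2 with x
  rw [rankOneFun, ← integral_smul]
  simp only [smul_comm (a (x m))]
  rfl

theorem rankOneFun_congr (h : f =ᵐ[volume] g) :
    rankOneFun a b m f =ᵐ[volume] rankOneFun a b m g := by
  have h1 : ∀ᵐ p : (Fin N → E) × E, f p.1 = g p.1 :=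
    Measure.quasiMeasurePreserving_fst.ae h
  have h2 := (measurePreserving_exchange m).quasiMeasurePreserving.ae h1
  filter_upwards [Measure.ae_ae_of_ae_prod h2] with x hx
  rw [rankOneFun, rankOneFun]
  congr 1
  refine integral_congr_ae ?_
  filter_upwards [hx] with y hy
  simp only [hy]

theorem integral_inner_rankOneFun [CompleteSpace F] (ha : MemLp a 2) (hb : MemLp b 2)
    (hf : MemLp f 2) (hg : MemLp g 2) :
    ∫ x, inner ℂ (g x) (rankOneFun a b m f x) = ∫ x, inner ℂ (rankOneFun b a m g x) (f x) := by
  have key : ∀ {a b : E → ℂ} {f g : (Fin N → E) → F}, MemLp a 2 → MemLp b 2 → MemLp f 2 →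
      MemLp g 2 → ∫ x, inner ℂ (g x) (rankOneFun a b m f x) =
        ∫ p : (Fin N → E) × E,
          inner ℂ (b p.2 • g p.1) (a (p.1 m) • f (Function.update p.1 m p.2)) := by
    intro a b f g ha hb hf hg
    have hF := memLp_smul_update ha hf m
    have hG := hg.smul_prod_two hb
    have hi : Integrable (fun p : (Fin N → E) × E =>
        inner ℂ (b p.2 • g p.1) (a (p.1 m) • f (Function.update p.1 m p.2))) := by
      refine (hG.norm.integrable_mul hF.norm).mono' (hG.1.inner hF.1) (.of_forall fun p => ?_)
      exact norm_inner_le_norm _ _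
    rw [Measure.volume_eq_prod, integral_prod _ hi]
    refine integral_congr_ae ?_
    filter_upwards [memLp_two_slice hF] with x hx
    rw [rankOneFun, ← integral_smul]
    rw [← integral_inner]
    · congr 1 with y
      simp only [inner_smul_left, inner_smul_right]
    · simp only [smul_comm (a (x m))]
      exact memLp_one_iff_integrable.1 (hx.smul hb.star)
  rw [key ha hb hf hg]
  have hs : ∫ x, inner ℂ (rankOneFun b a m g x) (f x) =
      (starRingEnd ℂ) (∫ x, inner ℂ (f x) (rankOneFun b a m g x)) := by
    rw [← integral_conj]
    simp only [inner_conj_symm]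
  rw [hs, key hb ha hg hf, ← integral_conj]
  simp only [inner_conj_symm]
  have hθ := measurePreserving_exchange (E := E) m
  have hF := memLp_smul_update hb hg m
  have hG := hf.smul_prod_two ha
  have h := integral_map hθ.measurable.aemeasurable (hθ.map_eq.symm ▸ hF.1.inner (𝕜 := ℂ) hG.1)
  rw [hθ.map_eq] at h
  refine Eq.trans ?_ h.symm
  simp only [Function.update_self, Function.update_idem, Function.update_eq_self]

theorem rankOneFun_comp_perm {σ : Equiv.Perm (Fin N)} {ε : ℂ}
    (hf : (fun x => f (x ∘ σ)) =ᵐ[volume] fun x => ε • f x) :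
    (fun x => rankOneFun a b m f (x ∘ σ)) =ᵐ[volume]
      fun x => ε • rankOneFun a b (σ m) f x := by
  have h1 (x : Fin N → E) : rankOneFun a b m f (x ∘ σ) =
      rankOneFun a b (σ m) (fun z => f (z ∘ σ)) x := by
    have hu (y : E) : Function.update (x ∘ σ) m y = Function.update x (σ m) y ∘ σ :=
      (Function.update_comp_eq_of_injective x σ.injective m y).symm
    simp only [rankOneFun, Function.comp_apply, hu]
  simp only [h1]
  filter_upwards [rankOneFun_congr (a := a) (b := b) (m := σ m) hf] with x hx
  rw [hx]
  simp only [rankOneFun, smul_comm _ ε, integral_smul]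

theorem integral_inner_eq_zero_of_comp_perm {σ : Equiv.Perm (Fin N)}
    (hf : AEStronglyMeasurable f) (hg : AEStronglyMeasurable g)
    (hfσ : (fun x => f (x ∘ σ)) =ᵐ[volume] f)
    (hgσ : (fun x => g (x ∘ σ)) =ᵐ[volume] fun x => -g x) :
    ∫ x, inner ℂ (f x) (g x) = 0 := by
  have hσ := measurePreserving_comp_perm (E := E) σ
  have h := integral_map hσ.measurable.aemeasurable (hσ.map_eq.symm ▸ hf.inner (𝕜 := ℂ) hg)
  rw [hσ.map_eq] at h
  have h' : ∫ x, inner ℂ (f (x ∘ σ)) (g (x ∘ σ)) = -∫ x, inner ℂ (f x) (g x) := by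
    rw [← integral_neg]
    refine integral_congr_ae ?_
    filter_upwards [hfσ, hgσ] with x hx h'x
    rw [hx, h'x, inner_neg_right]
  exact self_eq_neg.1 (h.trans h')

/-- The rank-one operator `|a⟩⟨b|` in the `m`-th variable, as a map on `L²`. -/
def rankOneLp (a b : Lp ℂ 2 (volume : Measure E)) (m : Fin N)
    (Ψ : Lp F 2 (volume : Measure (Fin N → E))) : Lp F 2 (volume : Measure (Fin N → E)) :=
  (memLp_rankOneFun (m := m) (Lp.memLp a) (Lp.memLp b) (Lp.memLp Ψ)).toLp _

variable {u v w z : Lp ℂ 2 (volume : Measure E)} {Φ Ψ : Lp F 2 (volume : Measure (Fin N → E))}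

theorem coeFn_rankOneLp : rankOneLp u v m Ψ =ᵐ[volume] rankOneFun u v m Ψ :=
  MemLp.coeFn_toLp _

theorem inner_rankOneLp [CompleteSpace F] :
    inner ℂ Φ (rankOneLp u v m Ψ) = inner ℂ (rankOneLp v u m Φ) Ψ := by
  rw [L2.inner_def, L2.inner_def]
  have h := integral_inner_rankOneFun (m := m) (Lp.memLp u) (Lp.memLp v) (Lp.memLp Ψ) (Lp.memLp Φ)
  refine (integral_congr_ae ?_).trans (h.trans (integral_congr_ae ?_))
  · filter_upwards [coeFn_rankOneLp (u := u) (v := v) (m := m) (Ψ := Ψ)] with x hx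
    rw [hx]
  · filter_upwards [coeFn_rankOneLp (u := v) (v := u) (m := m) (Ψ := Φ)] with x hx
    rw [hx]

theorem coeFn_rankOneLp_rankOneLp :
    rankOneLp u v l (rankOneLp w z m Ψ) =ᵐ[volume] rankOneFun u v l (rankOneFun w z m Ψ) :=
  coeFn_rankOneLp.trans (rankOneFun_congr coeFn_rankOneLp)

theorem rankOneLp_comp_self [CompleteSpace F] :
    rankOneLp u v m (rankOneLp w z m Ψ) = (inner ℂ v w : ℂ) • rankOneLp u z m Ψ := by
  refine Lp.ext ?_
  filter_upwards [coeFn_rankOneLp_rankOneLp (u := u) (v := v) (l := m) (w := w) (z := z) (m := m)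
    (Ψ := Ψ), coeFn_rankOneLp (u := u) (v := z) (m := m) (Ψ := Ψ),
    Lp.coeFn_smul (inner ℂ v w : ℂ) (rankOneLp u z m Ψ)] with x h1 h2 h3
  rw [h1, h3, Pi.smul_apply, h2, rankOneFun_comp_self, L2.inner_def]
  simp only [RCLike.inner_apply']

theorem inner_rankOneLp_eq_zero_of_antisymm [CompleteSpace F] (hlm : l ≠ m)
    (hΨ : (fun x => Ψ (x ∘ Equiv.swap l m)) =ᵐ[volume] fun x => -Ψ x) :
    inner ℂ (rankOneLp u u m Ψ) (rankOneLp u u l Ψ) = 0 := by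
  rw [inner_rankOneLp, L2.inner_def]
  have hc := coeFn_rankOneLp_rankOneLp (u := u) (v := u) (l := l) (w := u) (z := u) (m := m)
    (Ψ := Ψ)
  refine integral_inner_eq_zero_of_comp_perm (Lp.aestronglyMeasurable _)
    (Lp.aestronglyMeasurable _) ?_ hΨ
  filter_upwards [hc, (measurePreserving_comp_perm (E := E)
    (Equiv.swap l m)).quasiMeasurePreserving.ae hc] with x h1 h2
  rw [h1, h2, rankOneFun_comp_swap hlm]

theorem norm_rankOneLp_perm {σ : Equiv.Perm (Fin N)} {ε : ℂ} (hε : ‖ε‖ = 1)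
    (hΨ : (fun x => Ψ (x ∘ σ)) =ᵐ[volume] fun x => ε • Ψ x) :
    ‖rankOneLp u v (σ m) Ψ‖ = ‖rankOneLp u v m Ψ‖ := by
  rw [rankOneLp, rankOneLp, Lp.norm_toLp, Lp.norm_toLp]
  congr 1
  have h := eLpNorm_comp_measurePreserving (p := 2)
    (memLp_rankOneFun (m := m) (Lp.memLp u) (Lp.memLp v) (Lp.memLp Ψ)).1
    (measurePreserving_comp_perm σ)
  rw [← h]
  refine (eLpNorm_congr_norm_ae ?_).symm
  filter_upwards [rankOneFun_comp_perm (a := u) (b := v) (m := m) hΨ] with x hx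
  simp only [Function.comp_def] at hx ⊢
  rw [hx, norm_smul, hε, one_mul]

theorem norm_rankOneLp_eq [CompleteSpace F] (hu : ‖u‖ = 1) (hv : ‖v‖ = 1) :
    ‖rankOneLp u v m Ψ‖ = ‖rankOneLp v v m Ψ‖ := by
  have key {u : Lp ℂ 2 (volume : Measure E)} (hu : ‖u‖ = 1) :
      ((‖rankOneLp u v m Ψ‖ ^ 2 : ℝ) : ℂ) = inner ℂ (rankOneLp v v m Ψ) Ψ := by
    have := inner_self_eq_norm_sq_to_K (𝕜 := ℂ) (rankOneLp u v m Ψ)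
    rw [inner_rankOneLp, rankOneLp_comp_self, inner_self_eq_norm_sq_to_K, hu] at this
    simpa using this.symm
  have h := (key hu).trans (key hv).symm
  exact (sq_eq_sq₀ (norm_nonneg _) (norm_nonneg _)).1 (by exact_mod_cast h)

end RankOne

theorem norm_sum_sq_of_pairwise_inner_eq_zero {V ι : Type*} [NormedAddCommGroup V]
    [InnerProductSpace ℂ V] (s : Finset ι) (v : ι → V)
    (hv : ∀ i ∈ s, ∀ k ∈ s, i ≠ k → inner ℂ (v i) (v k) = 0) :
    ‖∑ i ∈ s, v i‖ ^ 2 = ∑ i ∈ s, ‖v i‖ ^ 2 := by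
  have h : (inner ℂ (∑ i ∈ s, v i) (∑ i ∈ s, v i) : ℂ) = ∑ i ∈ s, inner ℂ (v i) (v i) := by
    rw [sum_inner]
    refine Finset.sum_congr rfl fun i hi => ?_
    rw [inner_sum, Finset.sum_eq_single_of_mem i hi fun k hk hki => hv i hi k hk hki.symm]
  simp only [inner_self_eq_norm_sq_to_K] at h
  exact_mod_cast h

/-- A Bessel inequality for the orthogonal components `v i` of a vector `x`. -/
theorem sum_norm_sq_le_of_inner_eq {V ι : Type*} [NormedAddCommGroup V]
    [InnerProductSpace ℂ V] (s : Finset ι) (v : ι → V) (x : V)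
    (hv : ∀ i ∈ s, ∀ k ∈ s, i ≠ k → inner ℂ (v i) (v k) = 0)
    (hx : ∀ i ∈ s, (inner ℂ x (v i) : ℂ) = inner ℂ (v i) (v i)) :
    ∑ i ∈ s, ‖v i‖ ^ 2 ≤ ‖x‖ ^ 2 := by
  have h1 := norm_sum_sq_of_pairwise_inner_eq_zero s v hv
  have h2 : RCLike.re (inner ℂ x (∑ i ∈ s, v i) : ℂ) = ∑ i ∈ s, ‖v i‖ ^ 2 := by
    rw [inner_sum, map_sum]
    refine Finset.sum_congr rfl fun i hi => ?_
    rw [hx i hi, inner_self_eq_norm_sq]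
  have h3 := norm_sub_sq (𝕜 := ℂ) x (∑ i ∈ s, v i)
  nlinarith [sq_nonneg ‖x - ∑ i ∈ s, v i‖]

/-- A rank-one operator in one of `|S|` antisymmetric variables gains a factor `|S|⁻¹`. -/
theorem card_mul_norm_rankOneLp_sq_le {E F : Type*} [NormedAddCommGroup F] [InnerProductSpace ℂ F]
    [CompleteSpace F] [MeasureSpace E] [SigmaFinite (volume : Measure E)] {N : ℕ}
    {u v : Lp ℂ 2 (volume : Measure E)} (hu : ‖u‖ = 1) (hv : ‖v‖ = 1)
    {Ψ : Lp F 2 (volume : Measure (Fin N → E))} {S : Finset (Fin N)}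
    (hΨ : ∀ i ∈ S, ∀ k ∈ S, i ≠ k →
      (fun x => Ψ (x ∘ Equiv.swap i k)) =ᵐ[volume] fun x => -Ψ x) {m : Fin N} (hm : m ∈ S) :
    S.card * ‖rankOneLp u v m Ψ‖ ^ 2 ≤ ‖Ψ‖ ^ 2 := by
  have h := sum_norm_sq_le_of_inner_eq S (fun i => rankOneLp v v i Ψ) Ψ
    (fun i hi k hk hik => inner_rankOneLp_eq_zero_of_antisymm hik.symm (hΨ k hk i hi hik.symm))
    (fun i _ => by
      rw [inner_rankOneLp, inner_rankOneLp, rankOneLp_comp_self, inner_self_eq_norm_sq_to_K, hv]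
      simp)
  have h' : ∀ i ∈ S, ‖rankOneLp v v i Ψ‖ ^ 2 = ‖rankOneLp u v m Ψ‖ ^ 2 := by
    intro i hi
    rw [norm_rankOneLp_eq hu hv]
    by_cases him : m = i
    · rw [him]
    have hs : (fun x => Ψ (x ∘ Equiv.swap m i)) =ᵐ[volume] fun x => (-1 : ℂ) • Ψ x := by
      simpa only [neg_one_smul] using hΨ m hm i hi him
    have := norm_rankOneLp_perm (u := v) (v := v) (m := m) (by simp) hs
    rw [Equiv.swap_apply_left] at this
    rw [this]
  rwa [Finset.sum_congr rfl h', Finset.sum_const, nsmul_eq_mul] at h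

/-- for `Ψ` antisymmetric in the variables indexed by `S` (with `1 ∈ S`,
`|S| = N - j`), and `A₁ = ∑ᵢ μᵢ (|χ'ᵢ⟩⟨χᵢ|)₁` (convergence in operator norm, `∑ μᵢ² < ∞`),
one has `‖A₁ Ψ‖² ≤ (N - j)⁻¹ (∑ᵢ μᵢ²) ‖Ψ‖²`. -/
theorem statement1 (N j : ℕ) (hN : 1 ≤ N) (hj : j ≤ N - 1)
    (S : Finset (Fin N)) (h1S : (⟨0, hN⟩ : Fin N) ∈ S) (hScard : S.card = N - j)
    (Ψ : NL2 H N) (hΨ : AntisymmetricOn S Ψ)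
    (χ' χ : ℕ → OneL2) (hχ' : Orthonormal ℂ χ') (hχ : Orthonormal ℂ χ)
    (μ : ℕ → ℝ) (hμ : ∀ i, 0 ≤ μ i) (hμsum : Summable (fun i => (μ i) ^ 2))
    (R : ℕ → (NL2 H N →L[ℂ] NL2 H N))
    (hR : ∀ i, IsRankOneAt (χ' i) (χ i) (⟨0, hN⟩ : Fin N) (R i))
    (A : NL2 H N →L[ℂ] NL2 H N)
    (hA : HasSum (fun i => (μ i : ℂ) • R i) A) :
    ‖A Ψ‖ ^ 2 ≤ ((N : ℝ) - j)⁻¹ * (∑' i, (μ i) ^ 2) * ‖Ψ‖ ^ 2 := by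
  have hj' : j ≤ N := hj.trans (Nat.sub_le N 1)
  have hcard : (S.card : ℝ) = (N : ℝ) - j := by rw [hScard, Nat.cast_sub hj']
  have hpos : 0 < (N : ℝ) - j := by
    rw [← hcard]
    exact_mod_cast Finset.card_pos.2 ⟨_, h1S⟩
  have hRΨ (i : ℕ) : R i Ψ = rankOneLp (χ' i) (χ i) ⟨0, hN⟩ Ψ :=
    Lp.ext ((hR i Ψ).trans coeFn_rankOneLp.symm)
  have hswap : ∀ i ∈ S, ∀ k ∈ S, i ≠ k →
      (fun x => Ψ (x ∘ Equiv.swap i k)) =ᵐ[volume] fun x => -Ψ x := by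
    intro i hi k hk hik
    have h := hΨ (Equiv.swap i k) fun l hl => Equiv.swap_apply_of_ne_of_ne
      (fun h => hl (h ▸ hi)) (fun h => hl (h ▸ hk))
    simpa [Equiv.Perm.sign_swap hik] using h
  have hbound (i : ℕ) : ‖R i Ψ‖ ^ 2 ≤ ((N : ℝ) - j)⁻¹ * ‖Ψ‖ ^ 2 := by
    have h := card_mul_norm_rankOneLp_sq_le (hχ'.1 i) (hχ.1 i) hswap h1S
    rw [hcard, ← hRΨ] at h
    rwa [le_inv_mul_iff₀ hpos]
  have horth : ∀ i k, i ≠ k → inner ℂ ((μ i : ℂ) • R i Ψ) ((μ k : ℂ) • R k Ψ) = 0 := by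
    intro i k hik
    rw [inner_smul_left, inner_smul_right, hRΨ, hRΨ, inner_rankOneLp, rankOneLp_comp_self,
      hχ'.2 hik.symm]
    simp
  have hfin (s : Finset ℕ) : ‖∑ i ∈ s, (μ i : ℂ) • R i Ψ‖ ^ 2 ≤
      ((N : ℝ) - j)⁻¹ * (∑' i, (μ i) ^ 2) * ‖Ψ‖ ^ 2 := by
    rw [norm_sum_sq_of_pairwise_inner_eq_zero s _ fun i _ k _ => horth i k]
    calc ∑ i ∈ s, ‖(μ i : ℂ) • R i Ψ‖ ^ 2
        ≤ ∑ i ∈ s, (μ i) ^ 2 * (((N : ℝ) - j)⁻¹ * ‖Ψ‖ ^ 2) := by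
          refine Finset.sum_le_sum fun i _ => ?_
          rw [norm_smul, mul_pow, Complex.norm_real, Real.norm_eq_abs, sq_abs]
          exact mul_le_mul_of_nonneg_left (hbound i) (sq_nonneg _)
      _ = (∑ i ∈ s, (μ i) ^ 2) * (((N : ℝ) - j)⁻¹ * ‖Ψ‖ ^ 2) := by rw [Finset.sum_mul]
      _ ≤ (∑' i, (μ i) ^ 2) * (((N : ℝ) - j)⁻¹ * ‖Ψ‖ ^ 2) :=
          mul_le_mul_of_nonneg_right (hμsum.sum_le_tsum s fun i _ => sq_nonneg _) (by positivity)
      _ = ((N : ℝ) - j)⁻¹ * (∑' i, (μ i) ^ 2) * ‖Ψ‖ ^ 2 := by ring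
  have hsum : HasSum (fun i => (μ i : ℂ) • R i Ψ) (A Ψ) :=
    hA.mapL (ContinuousLinearMap.apply ℂ (NL2 H N) Ψ)
  exact le_of_tendsto ((continuous_norm.pow 2).continuousAt.tendsto.comp hsum)
    (Filter.Eventually.of_forall hfin)
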